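/- arXiv:1006.5544 — 5 statements merged into one kernel-verified Lean document; each statement's English description precedes it below -/
import Mathlib

section
/- Let k be an odd natural number, j a natural number, and n a natural number divisible by k·2^(j+1). Then among the multiples of k below n, exactly as many have their j-th binary digit equal to 1 as have it equal to 0; i.e., the cardinality of {x ∈ Finset.range n : k ∣ x ∧ Nat.testBit x j = true} equals the cardinality of {x ∈ Finset.range n : k ∣ x ∧ Nat.testBit x j = false}. -/
/-- Adding an odd multiple of `2 ^ j` modulo a multiple of `2 ^ (j + 1)` flips the `j`-th bit. -/
theorem testBit_add_odd_mul_two_pow_mod {k j n : ℕ} (hodd : Odd k) (hn : 2 ^ (j + 1) ∣ n) (x : ℕ) :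
    Nat.testBit ((x + k * 2 ^ j) % n) j = !Nat.testBit x j := by
  obtain ⟨m, rfl⟩ := hn
  have hdiv : (x + k * 2 ^ j) % (2 ^ (j + 1) * m) / 2 ^ j % 2 = (x / 2 ^ j + k) % 2 := by
    rw [pow_succ, mul_assoc, Nat.mod_mul_right_div_self, Nat.mod_mul_right_mod,
      Nat.add_mul_div_right _ _ (by positivity)]
  obtain ⟨l, rfl⟩ := hodd
  rw [Nat.testBit_eq_decide_div_mod_eq, Nat.testBit_eq_decide_div_mod_eq, hdiv, ← decide_not,
    decide_eq_decide]
  omega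

/-- Translation by `k * 2 ^ j` modulo `n` injects the multiples of `k` with `j`-th bit `b` into
those with `j`-th bit `!b`. -/
theorem card_multiples_testBit_le {k j n : ℕ} (hodd : Odd k) (hn : k * 2 ^ (j + 1) ∣ n)
    (b : Bool) :
    ((Finset.range n).filter (fun x => k ∣ x ∧ Nat.testBit x j = b)).card ≤
      ((Finset.range n).filter (fun x => k ∣ x ∧ Nat.testBit x j = !b)).card := by
  refine Finset.card_le_card_of_injOn (fun x => (x + k * 2 ^ j) % n) ?_ ?_
  · intro x hx
    simp only [Finset.coe_filter, Finset.mem_range, Set.mem_ofPred_eq] at hx ⊢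
    obtain ⟨hlt, hdvd, hbit⟩ := hx
    refine ⟨Nat.mod_lt _ (by omega), ?_, ?_⟩
    · exact (Nat.dvd_mod_iff (dvd_of_mul_right_dvd hn)).2 (hdvd.add (dvd_mul_right _ _))
    · rw [testBit_add_odd_mul_two_pow_mod hodd (dvd_of_mul_left_dvd hn), hbit]
  · intro x hx y hy hxy
    simp only [Finset.coe_filter, Finset.mem_range, Set.mem_ofPred_eq] at hx hy
    exact (Nat.ModEq.add_right_cancel' _ hxy).eq_of_lt_of_lt hx.1 hy.1

/-- For odd `k` and `n` divisible by `k * 2 ^ (j+1)`, among the multiples of `k`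
below `n` exactly as many have their `j`-th binary digit equal to `1` as have
it equal to `0`. -/
theorem stmt_3 (k j n : ℕ) (hodd : Odd k) (hn : k * 2 ^ (j + 1) ∣ n) :
    ((Finset.range n).filter (fun x => k ∣ x ∧ Nat.testBit x j = true)).card =
      ((Finset.range n).filter (fun x => k ∣ x ∧ Nat.testBit x j = false)).card :=
  le_antisymm (card_multiples_testBit_le hodd hn true) (card_multiples_testBit_le hodd hn false)
end

section
/- Let k be an odd natural number and j a natural number. Then the number of l in Finset.range (2^(j+1)) for which Nat.testBit (k·l) j = true is exactly 2^j. -/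
/-- Adding `2 ^ j` to the multiplier of an odd number flips the `j`-th bit of the product. -/
theorem testBit_odd_mul_two_pow_add {k : ℕ} (hodd : Odd k) (j l : ℕ) :
    Nat.testBit (k * (2 ^ j + l)) j = !Nat.testBit (k * l) j := by
  have hdiv : k * (2 ^ j + l) / 2 ^ j = k + k * l / 2 ^ j := by
    rw [mul_add, mul_comm k (2 ^ j), Nat.mul_add_div (by positivity)]
  have hk := Nat.odd_iff.mp hodd
  rw [Nat.testBit_eq_decide_div_mod_eq, Nat.testBit_eq_decide_div_mod_eq, hdiv,
    ← decide_not, decide_eq_decide]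
  omega

/-- For odd `k`, among any `2 ^ (j+1)` consecutive multiples `k * l`,
`l = 0, …, 2^(j+1) - 1`, exactly `2 ^ j` have their `j`-th binary digit equal
to `1`. -/
theorem stmt_4 (k j : ℕ) (hodd : Odd k) :
    ((Finset.range (2 ^ (j + 1))).filter
        (fun l => Nat.testBit (k * l) j = true)).card = 2 ^ j := by
  rw [Finset.card_filter, pow_succ, mul_two, Finset.sum_range_add, ← Finset.sum_add_distrib]
  simp only [testBit_odd_mul_two_pow_add hodd]
  rw [Finset.sum_congr rfl (g := fun _ => 1)]
  · simp
  · intro l _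
    cases Nat.testBit (k * l) j <;> rfl
end

section
/- Let k ≥ 1 and let N, j be natural numbers with j + 1 ≤ N. Then the number of multiples of k below 2^N whose j-th binary digit is 1 and the number whose j-th binary digit is 0 differ by at most 2^(N−j−1); i.e., |card {x ∈ Finset.range (2^N) : k ∣ x ∧ Nat.testBit x j = true} − card {x ∈ Finset.range (2^N) : k ∣ x ∧ Nat.testBit x j = false}| ≤ 2^(N−j−1). -/
/-- Two adjacent intervals of length `L` contain numbers of multiples of `k` differing by at
most one. -/
theorem abs_card_multiples_adjacent_sub_le_one {k : ℕ} (hk : 0 < k) (a L : ℕ) :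
    |(∑ i ∈ Finset.range L, if k ∣ a + L + i then (1 : ℤ) else 0) -
      ∑ i ∈ Finset.range L, if k ∣ a + i then (1 : ℤ) else 0| ≤ 1 := by
  have card_range (n : ℕ) :
      (∑ x ∈ Finset.range n, if k ∣ x then (1 : ℤ) else 0) = ((n + (k - 1)) / k : ℕ) := by
    induction n with
    | zero => simp [Nat.div_eq_of_lt (Nat.sub_lt hk one_pos)]
    | succ n ih =>
      have hdvd : k ∣ n + (k - 1) + 1 ↔ k ∣ n := by
        rw [show n + (k - 1) + 1 = n + k by omega, Nat.dvd_add_self_right]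
      rw [Finset.sum_range_succ, ih, show n + 1 + (k - 1) = n + (k - 1) + 1 by omega,
        Nat.succ_div]
      simp only [hdvd]
      push_cast
      rfl
  have card_shift (b : ℕ) : ∃ e : ℤ, 0 ≤ e ∧ e ≤ 1 ∧
      (∑ i ∈ Finset.range L, if k ∣ b + i then (1 : ℤ) else 0) = (L / k : ℕ) + e := by
    have h := Finset.sum_range_add (fun x => if k ∣ x then (1 : ℤ) else 0) b L
    rw [card_range, card_range, show b + L + (k - 1) = b + (k - 1) + L by omega,
      Nat.add_div hk] at h
    refine ⟨if k ≤ (b + (k - 1)) % k + L % k then 1 else 0, ?_, ?_, ?_⟩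
    · split_ifs <;> simp
    · split_ifs <;> simp
    · push_cast at h ⊢
      linarith
  obtain ⟨e, he0, he1, he⟩ := card_shift a
  obtain ⟨e', he0', he1', he'⟩ := card_shift (a + L)
  rw [he, he', abs_le]
  constructor <;> linarith

/-- The signed count of multiples of `k` below `m * 2 ^ (j + 1)`, with sign given by the `j`-th
binary digit, is at most `m` in absolute value. -/
theorem abs_sum_multiples_sign_testBit_le {k : ℕ} (hk : 0 < k) (j m : ℕ) :
    |∑ x ∈ Finset.range (m * 2 ^ (j + 1)),
      if k ∣ x then (if x.testBit j then (1 : ℤ) else -1) else 0| ≤ m := by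
  induction m with
  | zero => simp
  | succ m ih =>
    have bit_low {i : ℕ} (hi : i < 2 ^ j) : (m * 2 ^ (j + 1) + i).testBit j = false := by
      rw [mul_comm, Nat.testBit_two_pow_mul_add _ (hi.trans (Nat.pow_lt_pow_succ one_lt_two)),
        if_pos j.lt_succ_self, Nat.testBit_lt_two_pow hi]
    have bit_high {i : ℕ} (hi : i < 2 ^ j) :
        (m * 2 ^ (j + 1) + 2 ^ j + i).testBit j = true := by
      rw [show m * 2 ^ (j + 1) + 2 ^ j + i = 2 ^ j + (m * 2 ^ (j + 1) + i) by ring,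
        Nat.testBit_two_pow_add_eq, bit_low hi, Bool.not_false]
    have low : (∑ i ∈ Finset.range (2 ^ j), if k ∣ m * 2 ^ (j + 1) + i then
          (if (m * 2 ^ (j + 1) + i).testBit j then (1 : ℤ) else -1) else 0) =
        -∑ i ∈ Finset.range (2 ^ j), if k ∣ m * 2 ^ (j + 1) + i then (1 : ℤ) else 0 := by
      rw [← Finset.sum_neg_distrib]
      refine Finset.sum_congr rfl fun i hi => ?_
      rw [bit_low (Finset.mem_range.mp hi)]
      split_ifs <;> simp_all
    have high : (∑ i ∈ Finset.range (2 ^ j), if k ∣ m * 2 ^ (j + 1) + 2 ^ j + i then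
          (if (m * 2 ^ (j + 1) + 2 ^ j + i).testBit j then (1 : ℤ) else -1) else 0) =
        ∑ i ∈ Finset.range (2 ^ j),
          if k ∣ m * 2 ^ (j + 1) + 2 ^ j + i then (1 : ℤ) else 0 := by
      refine Finset.sum_congr rfl fun i hi => ?_
      rw [bit_high (Finset.mem_range.mp hi), if_pos rfl]
    have adj := abs_card_multiples_adjacent_sub_le_one hk (m * 2 ^ (j + 1)) (2 ^ j)
    rw [show (m + 1) * 2 ^ (j + 1) = m * 2 ^ (j + 1) + 2 ^ j + 2 ^ j by ring,
      Finset.sum_range_add, Finset.sum_range_add, low, high]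
    rw [abs_le] at ih adj ⊢
    push_cast
    constructor <;> linarith

/-- For `k ≥ 1` and `j + 1 ≤ N`, the numbers of multiples of `k` below `2 ^ N`
with `j`-th binary digit `1` and with `j`-th binary digit `0` differ by at
most `2 ^ (N - j - 1)`. -/
theorem stmt_5 (k N j : ℕ) (hk : 1 ≤ k) (hj : j + 1 ≤ N) :
    |(((Finset.range (2 ^ N)).filter
          (fun x => k ∣ x ∧ Nat.testBit x j = true)).card : ℤ) -
        (((Finset.range (2 ^ N)).filter
          (fun x => k ∣ x ∧ Nat.testBit x j = false)).card : ℤ)| ≤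
      2 ^ (N - j - 1) := by
  have h := abs_sum_multiples_sign_testBit_le hk j (2 ^ (N - j - 1))
  rw [← pow_add, show N - j - 1 + (j + 1) = N by omega] at h
  push_cast at h
  convert h using 2
  rw [Finset.card_filter, Finset.card_filter]
  push_cast
  rw [← Finset.sum_sub_distrib]
  refine Finset.sum_congr rfl fun x _ => ?_
  by_cases hx : k ∣ x <;> cases x.testBit j <;> simp [hx]
end

section
/- Let M and m₀ be natural numbers with 1 ≤ m₀ ≤ M, and let d be a real number with 0 < d < 1 such that d·(M−1) ≤ m₀ − 1. Then ∑_{m=m₀}^{M} (M choose m) d^m (1−d)^(M−m) ≤ m₀ · (M choose m₀) · d^(m₀) · (1−d)^(M−m₀). -/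
/-- The ratio of consecutive terms of the binomial distribution, with denominators cleared. -/
theorem binomial_term_succ {R : Type*} [CommRing R] {n k : ℕ} (hk : k < n) (p : R) :
    ((k : R) + 1) * (1 - p) * ((n.choose (k + 1) : R) * p ^ (k + 1) * (1 - p) ^ (n - (k + 1))) =
      ((n : R) - k) * p * ((n.choose k : R) * p ^ k * (1 - p) ^ (n - k)) := by
  have hchoose : (n.choose (k + 1) : R) * ((k : R) + 1) = n.choose k * ((n : R) - k) := by
    rw [← Nat.cast_sub hk.le]
    exact_mod_cast congrArg (Nat.cast : ℕ → R) (Nat.choose_succ_right_eq n k)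
  have hsub : n - k = n - (k + 1) + 1 := by omega
  rw [hsub, pow_succ (1 - p), pow_succ p]
  linear_combination (1 - p) * p ^ k * p * (1 - p) ^ (n - (k + 1)) * hchoose

/-- If `c * t (k + 1) ≤ (c - 1) * t k` along a finite sequence, its tails are at most `c` times
their first term. -/
theorem sum_Icc_le_mul_of_mul_succ_le {t : ℕ → ℝ} {c : ℝ} {a n : ℕ} (han : a ≤ n)
    (hlast : t n ≤ c * t n) (hstep : ∀ k, a ≤ k → k < n → c * t (k + 1) ≤ (c - 1) * t k) :
    ∑ m ∈ Finset.Icc a n, t m ≤ c * t a := by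
  induction han using Nat.decreasingInduction with
  | self => simpa using hlast
  | of_succ k hk ih =>
    have htail := ih fun j hj => hstep j (by omega)
    rw [← Finset.add_sum_Ioc_eq_sum_Icc (by omega), ← Finset.Icc_add_one_left_eq_Ioc]
    linarith [hstep k le_rfl hk]

/-- If `0 < d < 1` and `d (M - 1) ≤ m₀ - 1`, then the binomial tail satisfies
`∑_{m=m₀}^{M} (M choose m) d^m (1-d)^(M-m) ≤ m₀ (M choose m₀) d^(m₀) (1-d)^(M-m₀)`. -/
theorem stmt_9 (M m₀ : ℕ) (h1 : 1 ≤ m₀) (h2 : m₀ ≤ M) (d : ℝ) (hd0 : 0 < d)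
    (hd1 : d < 1) (hcond : d * ((M : ℝ) - 1) ≤ (m₀ : ℝ) - 1) :
    ∑ m ∈ Finset.Icc m₀ M, (M.choose m : ℝ) * d ^ m * (1 - d) ^ (M - m) ≤
      (m₀ : ℝ) * (M.choose m₀ : ℝ) * d ^ m₀ * (1 - d) ^ (M - m₀) := by
  have hq : 0 < 1 - d := by linarith
  have hm : (1 : ℝ) ≤ m₀ := by exact_mod_cast h1
  set t : ℕ → ℝ := fun m => (M.choose m : ℝ) * d ^ m * (1 - d) ^ (M - m) with ht
  have ht0 (m : ℕ) : 0 ≤ t m := by positivity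
  have hmain : ∑ m ∈ Finset.Icc m₀ M, t m ≤ m₀ * t m₀ := by
    refine sum_Icc_le_mul_of_mul_succ_le h2 (le_mul_of_one_le_left (ht0 M) hm) fun k hk hkM => ?_
    have hk' : (m₀ : ℝ) ≤ k := by exact_mod_cast hk
    have hratio : ((k : ℝ) + 1) * (1 - d) * t (k + 1) = ((M : ℝ) - k) * d * t k :=
      binomial_term_succ hkM d
    have hcoef : ((M : ℝ) - k) * d ≤ (m₀ - 1) * (1 - d) := by
      linarith [mul_le_mul_of_nonneg_right hk' hd0.le]
    refine le_of_mul_le_mul_left ?_ hq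
    calc (1 - d) * (m₀ * t (k + 1)) = m₀ * ((1 - d) * t (k + 1)) := by ring
      _ ≤ (k + 1) * ((1 - d) * t (k + 1)) :=
        mul_le_mul_of_nonneg_right (by linarith) (mul_nonneg hq.le (ht0 _))
      _ = ((M : ℝ) - k) * d * t k := by rw [← hratio]; ring
      _ ≤ (m₀ - 1) * (1 - d) * t k := mul_le_mul_of_nonneg_right hcoef (ht0 k)
      _ = (1 - d) * ((m₀ - 1) * t k) := by ring
  simpa only [ht, mul_assoc] using hmain
end

section
/- Every 3×3 real special orthogonal matrix A (i.e., AᵀA = 1 and det A = 1) can be written as a product A = B·C·D of three 3×3 real special orthogonal matrices B, C, D, each of which fixes some nonzero vector of ℝ³ whose third coordinate is zero (i.e., each is a rotation about an axis lying in the x–y plane). -/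
open Matrix

/-- Polar coordinates, with the direction `(p, q)` rotated by a quarter turn. -/
lemma exists_unit_normal (x y : ℝ) :
    ∃ p q k : ℝ, p ^ 2 + q ^ 2 = 1 ∧ x = -(k * q) ∧ y = k * p := by
  by_cases h : x ^ 2 + y ^ 2 = 0
  · refine ⟨1, 0, 0, by norm_num, ?_, ?_⟩ <;> nlinarith [sq_nonneg x, sq_nonneg y]
  · have hpos : 0 < x ^ 2 + y ^ 2 := lt_of_le_of_ne (by positivity) (Ne.symm h)
    have hk : √(x ^ 2 + y ^ 2) ≠ 0 := (Real.sqrt_pos.2 hpos).ne'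
    have hs : √(x ^ 2 + y ^ 2) ^ 2 = x ^ 2 + y ^ 2 := Real.sq_sqrt hpos.le
    refine ⟨y / √(x ^ 2 + y ^ 2), -x / √(x ^ 2 + y ^ 2), √(x ^ 2 + y ^ 2), ?_, ?_, ?_⟩
    · rw [div_pow, div_pow, hs]
      field_simp
      ring
    · field_simp
    · field_simp

/-- Every unit vector is the image of the third basis vector under a rotation about an axis
in the x–y plane. -/
lemma exists_planar_rotation_third_column (x y z : ℝ) (h : x ^ 2 + y ^ 2 + z ^ 2 = 1) :
    ∃ B : Matrix (Fin 3) (Fin 3) ℝ, Bᵀ * B = 1 ∧ B.det = 1 ∧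
      (∃ v : Fin 3 → ℝ, v ≠ 0 ∧ v 2 = 0 ∧ B.mulVec v = v) ∧
      B 0 2 = x ∧ B 1 2 = y ∧ B 2 2 = z := by
  obtain ⟨p, q, k, hpq, rfl, rfl⟩ := exists_unit_normal x y
  have hk : k ^ 2 + z ^ 2 = 1 := by linear_combination h - k ^ 2 * hpq
  refine ⟨!![p ^ 2 + z * q ^ 2, p * q - z * p * q, -(k * q);
    p * q - z * p * q, q ^ 2 + z * p ^ 2, k * p; k * q, -(k * p), z], ?_, ?_,
    ⟨![p, q, 0], ?_, rfl, ?_⟩, rfl, rfl, rfl⟩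
  · ext i j
    fin_cases i <;> fin_cases j <;> simp [Matrix.mul_apply, Fin.sum_univ_three] <;> grind
  · simp [Matrix.det_fin_three]
    grind
  · intro hv
    have h0 : p = 0 := congrFun hv 0
    have h1 : q = 0 := congrFun hv 1
    simp [h0, h1] at hpq
  · ext i
    fin_cases i <;> simp [Matrix.mulVec, dotProduct, Fin.sum_univ_three] <;> grind

/-- Composing a rotation about the z-axis with the half-turn about the x-axis gives a rotation
about an axis in the x–y plane. -/
lemma exists_planar_fixed_vector (R : Matrix (Fin 3) (Fin 3) ℝ) (hR : Rᵀ * R = 1)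
    (hdet : R.det = 1) (h0 : R 0 2 = 0) (h1 : R 1 2 = 0) (h2 : R 2 2 = 1) :
    ∃ v : Fin 3 → ℝ, v ≠ 0 ∧ v 2 = 0 ∧ (diagonal ![1, -1, -1] * R).mulVec v = v := by
  have e (i j : Fin 3) := congrFun (congrFun hR i) j
  simp only [Matrix.mul_apply, Fin.sum_univ_three, transpose_apply] at e
  have e02 := e 0 2
  have e12 := e 1 2
  have e00 := e 0 0
  have e11 := e 1 1
  simp only [h0, h1, h2, one_apply_eq, ne_eq, Fin.reduceEq, not_false_eq_true, one_apply_ne,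
    mul_zero, mul_one, zero_add] at e02 e12 e00 e11
  simp only [det_fin_three, h0, h1, h2, e02, e12] at hdet
  simp only [e02, e12] at e00 e11
  have hsq : (R 0 0 - R 1 1) ^ 2 + (R 0 1 + R 1 0) ^ 2 = 0 := by
    linear_combination e00 + e11 - 2 * hdet
  have hd : R 1 1 = R 0 0 := by nlinarith [sq_nonneg (R 0 0 - R 1 1), sq_nonneg (R 0 1 + R 1 0)]
  have hb : R 0 1 = -R 1 0 := by nlinarith [sq_nonneg (R 0 0 - R 1 1), sq_nonneg (R 0 1 + R 1 0)]
  by_cases hc : R 0 0 = -1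
  · have hs : R 1 0 = 0 := by
      rw [hc] at e00
      nlinarith
    refine ⟨![0, 1, 0], fun hv => one_ne_zero (congrFun hv 1 : (1 : ℝ) = 0), rfl, ?_⟩
    ext i
    fin_cases i <;>
      simp [Matrix.mulVec, dotProduct, Fin.sum_univ_three, diagonal_mul, hb, hd, hs, hc, e12]
  · refine ⟨![1 + R 0 0, -R 1 0, 0], fun hv => hc ?_, rfl, ?_⟩
    · have : 1 + R 0 0 = 0 := congrFun hv 0
      linarith
    · ext i
      fin_cases i <;>
        simp [Matrix.mulVec, dotProduct, Fin.sum_univ_three, diagonal_mul, hb, hd, e02, e12] <;>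
        grind

/-- Every 3×3 real special orthogonal matrix is a product of three special
orthogonal matrices, each fixing a nonzero vector whose third coordinate is
zero (i.e. each a rotation about an axis in the x–y plane). -/
theorem stmt_12 (A : Matrix (Fin 3) (Fin 3) ℝ) (hA : Aᵀ * A = 1)
    (hdet : A.det = 1) :
    ∃ B C D : Matrix (Fin 3) (Fin 3) ℝ,
      (Bᵀ * B = 1 ∧ B.det = 1 ∧
        ∃ v : Fin 3 → ℝ, v ≠ 0 ∧ v 2 = 0 ∧ B.mulVec v = v) ∧
      (Cᵀ * C = 1 ∧ C.det = 1 ∧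
        ∃ v : Fin 3 → ℝ, v ≠ 0 ∧ v 2 = 0 ∧ C.mulVec v = v) ∧
      (Dᵀ * D = 1 ∧ D.det = 1 ∧
        ∃ v : Fin 3 → ℝ, v ≠ 0 ∧ v 2 = 0 ∧ D.mulVec v = v) ∧
      A = B * C * D := by
  have hcol : A 0 2 ^ 2 + A 1 2 ^ 2 + A 2 2 ^ 2 = 1 := by
    have h := congrFun (congrFun hA 2) 2
    simp only [Matrix.mul_apply, Fin.sum_univ_three, transpose_apply, one_apply_eq] at h
    linear_combination h
  obtain ⟨B, hB, hBdet, hBv, hB0, hB1, hB2⟩ := exists_planar_rotation_third_column _ _ _ hcol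
  have hB' : B * Bᵀ = 1 := mul_eq_one_comm.1 hB
  have hR : (Bᵀ * A)ᵀ * (Bᵀ * A) = 1 := by
    rw [transpose_mul, transpose_transpose, Matrix.mul_assoc, ← Matrix.mul_assoc B, hB',
      Matrix.one_mul, hA]
  have hRdet : (Bᵀ * A).det = 1 := by rw [det_mul, det_transpose, hBdet, hdet, one_mul]
  have hRcol (i : Fin 3) : (Bᵀ * A) i 2 = (1 : Matrix (Fin 3) (Fin 3) ℝ) i 2 := by
    rw [← hB]
    simp only [Matrix.mul_apply, Fin.sum_univ_three, hB0, hB1, hB2]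
  have hC2 : (diagonal ![1, -1, -1] * diagonal ![1, -1, -1] : Matrix (Fin 3) (Fin 3) ℝ) = 1 := by
    rw [diagonal_mul_diagonal, ← diagonal_one]
    congr 1
    ext i
    fin_cases i <;> simp
  have hCdet : (diagonal ![1, -1, -1] : Matrix (Fin 3) (Fin 3) ℝ).det = 1 := by
    simp [det_diagonal, Fin.prod_univ_three]
  refine ⟨B, diagonal ![1, -1, -1], diagonal ![1, -1, -1] * (Bᵀ * A), ⟨hB, hBdet, hBv⟩,
    ⟨?_, hCdet, ![1, 0, 0], fun hv => one_ne_zero (congrFun hv 0 : (1 : ℝ) = 0), rfl, ?_⟩,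
    ⟨?_, ?_, exists_planar_fixed_vector _ hR hRdet (hRcol 0) (hRcol 1) (hRcol 2)⟩, ?_⟩
  · rw [diagonal_transpose, hC2]
  · ext i
    fin_cases i <;> simp [mulVec_diagonal]
  · rw [transpose_mul, diagonal_transpose, Matrix.mul_assoc, ← Matrix.mul_assoc (diagonal _), hC2,
      Matrix.one_mul, hR]
  · rw [det_mul, hCdet, hRdet, one_mul]
  · rw [Matrix.mul_assoc, ← Matrix.mul_assoc (diagonal _), hC2, Matrix.one_mul,
      ← Matrix.mul_assoc, hB', Matrix.one_mul]
end
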